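/- Let T be a rooted chain complete tree satisfying condition (*), endowed with the coarse wedge topology, and let A ∈ 𝒜(T). If t ∈ cl(A) and cf(t) = ω, then there exists a sequence {t_n}_{n∈ω} ⊆ A converging to t such that t_n < t for every n and each t_n lies on a successor level of T. -/

import Mathlib

open Cardinal Ordinal Filter Set Topology

universe u v

section TreeDefs

variable {T : Type u} [PartialOrder T]

/-- `T` is a tree: the set of strict predecessors of every point is well-ordered by `<`. -/
def IsTreeOrder (T : Type u) [PartialOrder T] : Prop :=
  ∀ x : T, IsWellOrder {y : T // y < x} (· < ·)

/-- Every chain has a supremum. -/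
def ChainComplete (T : Type u) [PartialOrder T] : Prop :=
  ∀ c : Set T, IsChain (· ≤ ·) c → ∃ s, IsLUB c s

open Classical in
/-- The height `ht(x,T)` of `x`: the order type of the set of its strict predecessors. -/
noncomputable def htx (x : T) : Ordinal.{u} :=
  if h : IsWellOrder {y : T // y < x} (· < ·) then @Ordinal.type {y : T // y < x} (· < ·) h
  else 0

/-- The cofinality `cf(x)` of `ht(x,T)`. -/
noncomputable def cfx (x : T) : Cardinal.{u} := (htx x).cof

/-- `x` lies on a successor level. -/
def SuccLevel (x : T) : Prop := ∃ β : Ordinal, htx x = β + 1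

/-- The set of immediate successors of `x`. -/
def ims (x : T) : Set T := {y | x < y ∧ htx y = htx x + 1}

/-- The wedge `V_t = {s : t ≤ s}`. -/
def Vset (t : T) : Set T := {s | t ≤ s}

/-- Condition (*): every `t` with `cf(t) ≥ ω₁` has finitely many immediate successors. -/
def StarCond (T : Type u) [PartialOrder T] : Prop :=
  ∀ t : T, Cardinal.aleph 1 ≤ cfx t → (ims t).Finite

/-- The coarse wedge topology: generated by the sets `V_t` and their complements,
for `t` minimal or on a successor level. -/
def coarseWedge (T : Type u) [PartialOrder T] : TopologicalSpace T :=
  TopologicalSpace.generateFrom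
    {U : Set T | ∃ t : T, (IsMin t ∨ SuccLevel t) ∧ (U = Vset t ∨ U = (Vset t)ᶜ)}

open Classical in
/-- `s ∧ t = max (ŝ ∩ t̂)`, the largest common predecessor (when it exists). -/
noncomputable def wedge (s t : T) : T :=
  if h : ∃ m, IsGreatest {r : T | r ≤ s ∧ r ≤ t} m then h.choose else s

open Classical in
/-- `ψ(t) = ims(t)` if `cf(t) ≥ ω₁`, and `ψ(t) = {0}` (the root) otherwise. -/
noncomputable def psiSet (root : T) (t : T) : Set T :=
  if Cardinal.aleph 1 ≤ cfx t then ims t else {root}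

/-- `φ` is a choice function assigning to every `t` with `cf(t) = ω` a sequence of
successor-level elements strictly below `t` converging to `t`, and the constant
sequence at the root otherwise. -/
def PhiSpec [TopologicalSpace T] (root : T) (φ : T → ℕ → T) : Prop :=
  ∀ t : T,
    (cfx t ≠ Cardinal.aleph0 → ∀ n, φ t n = root) ∧
    (cfx t = Cardinal.aleph0 →
      (∀ n, φ t n < t ∧ SuccLevel (φ t n)) ∧ Tendsto (φ t) atTop (nhds t))

/-- Membership in the family `𝒜(T)`: countable subsets containing the root, closed
under `∧`, `φ` and `ψ`. -/
structure Admissible (root : T) (φ : T → ℕ → T) (A : Set T) : Prop where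
  countable : A.Countable
  root_mem : root ∈ A
  wedge_mem : ∀ s ∈ A, ∀ t ∈ A, wedge s t ∈ A
  phi_mem : ∀ t ∈ A, ∀ n, φ t n ∈ A
  psi_mem : ∀ t ∈ A, psiSet root t ⊆ A

/-- The height of the tree `T`: the least `α` such that the level `α` of `T` is empty. -/
noncomputable def treeHeight (T : Type u) [PartialOrder T] : Ordinal.{u} :=
  sInf {α : Ordinal | ∀ x : T, htx x ≠ α}

end TreeDefs

/-- A retractional skeleton on a compact space `K`: a family of continuous retractions
with metrizable compact ranges, indexed by an up-directed partially ordered set,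
commuting under the order, continuous under countable increasing suprema, and
converging pointwise to the identity. -/
structure RetractionalSkeleton (K : Type v) [TopologicalSpace K] where
  Γ : Type v
  [po : PartialOrder Γ]
  [ne : Nonempty Γ]
  directed : ∀ s t : Γ, ∃ u, s ≤ u ∧ t ≤ u
  r : Γ → K → K
  cont : ∀ s, Continuous (r s)
  retraction : ∀ s x, r s (r s x) = r s x
  compact_range : ∀ s, IsCompact (Set.range (r s))
  metrizable_range : ∀ s, TopologicalSpace.MetrizableSpace (Set.range (r s))
  comm : ∀ s t : Γ, s ≤ t → ∀ x, r s (r t x) = r s x ∧ r t (r s x) = r s x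
  seq_sup : ∀ s : ℕ → Γ, Monotone s → ∃ t : Γ, IsLUB (Set.range s) t ∧
      ∀ x, Tendsto (fun n => r (s n) x) atTop (nhds (r t x))
  net_conv : ∀ x : K, Tendsto (fun s : Γ => r s x) atTop (nhds x)

/-- The subset induced by a retractional skeleton: `D = ⋃ₛ rₛ[K]`. -/
def RetractionalSkeleton.inducedSet {K : Type v} [TopologicalSpace K]
    (R : RetractionalSkeleton K) : Set K :=
  ⋃ s : R.Γ, Set.range (R.r s)

/-- `A` is a `Σ`-subset of `K`: for some homeomorphic injection `h` of `K` into a cube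
`[0,1]^Γ`, `h(A) = h(K) ∩ Σ(Γ)`. -/
def IsSigmaSubset {K : Type v} [TopologicalSpace K] (A : Set K) : Prop :=
  ∃ (Γ : Type v) (h : K → Γ → Set.Icc (0 : ℝ) 1),
    Topology.IsEmbedding h ∧
      h '' A = Set.range h ∩ {x | {γ | (x γ : ℝ) ≠ 0}.Countable}

/-- `K` is a Valdivia compact space: it has a dense `Σ`-subset. -/
def IsValdivia (K : Type v) [TopologicalSpace K] : Prop :=
  ∃ A : Set K, Dense A ∧ IsSigmaSubset A

/-- The bounded topology on a product `∏_{α<ω₁} X_α`: basic open sets are the sets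
`V(g,β) = {f : f↾β = g↾β}` for `β < ω₁`. -/
def boundedTopology (X : Set.Iio (Cardinal.aleph 1).ord → Type v) :
    TopologicalSpace (∀ α, X α) :=
  TopologicalSpace.generateFrom
    {U | ∃ (g : ∀ α, X α) (β : Ordinal), β < (Cardinal.aleph 1).ord ∧
      U = {f | ∀ α : Set.Iio (Cardinal.aleph 1).ord, (α : Ordinal) < β → f α = g α}}

section TreeLemmas

variable {T : Type u} [PartialOrder T]

lemma IsTreeOrder.le_total_of_le (htree : IsTreeOrder T) {x y z : T} (hx : x ≤ z) (hy : y ≤ z) :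
    x ≤ y ∨ y ≤ x := by
  rcases hx.eq_or_lt with rfl | hx
  · exact Or.inr hy
  rcases hy.eq_or_lt with rfl | hy
  · exact Or.inl hx.le
  have := htree z
  rcases trichotomous_of (fun a b : {y : T // y < z} => a < b) ⟨x, hx⟩ ⟨y, hy⟩ with h | h | h
  · exact Or.inl (le_of_lt h)
  · exact Or.inl (congrArg Subtype.val h).le
  · exact Or.inr (le_of_lt h)

lemma IsTreeOrder.htx_eq (htree : IsTreeOrder T) (x : T) :
    htx x = @Ordinal.type {y : T // y < x} (· < ·) (htree x) := by
  rw [htx, dif_pos (htree x)]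

lemma IsTreeOrder.typein_eq_htx (htree : IsTreeOrder T) {x y : T} (h : y < x) :
    @Ordinal.typein {z : T // z < x} (· < ·) (htree x) ⟨y, h⟩ = htx y := by
  have := htree x
  have := htree y
  rw [htree.htx_eq y]
  let f : PrincipalSeg (fun a b : {z : T // z < y} => a < b)
      (fun a b : {z : T // z < x} => a < b) :=
    { toFun := fun z => ⟨z.1, z.2.trans h⟩
      inj' := fun a b hab => Subtype.ext (congrArg (fun z => z.1) hab)
      map_rel_iff' := Iff.rfl
      top := ⟨y, h⟩
      mem_range_iff_rel' := by
        rintro ⟨z, hz⟩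
        constructor
        · rintro ⟨w, hw⟩
          have : w.1 = z := congrArg Subtype.val hw
          exact this ▸ w.2
        · intro hzy
          exact ⟨⟨z, hzy⟩, rfl⟩ }
  exact Ordinal.typein_top f

lemma IsTreeOrder.htx_lt (htree : IsTreeOrder T) {x y : T} (h : y < x) : htx y < htx x := by
  have := htree x
  rw [← htree.typein_eq_htx h, htree.htx_eq x]
  exact Ordinal.typein_lt_type _ _

lemma IsTreeOrder.exists_htx_eq (htree : IsTreeOrder T) {x : T} {o : Ordinal} (h : o < htx x) :
    ∃ y < x, htx y = o := by
  have := htree x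
  rw [htree.htx_eq x] at h
  obtain ⟨⟨y, hy⟩, rfl⟩ := Ordinal.typein_surj _ h
  exact ⟨y, hy, (htree.typein_eq_htx hy).symm⟩

/-- Below any point strictly above `t` there is a least point strictly above `t`, and it is an
immediate successor of `t`. -/
lemma IsTreeOrder.exists_mem_ims_le (htree : IsTreeOrder T) {t a : T} (h : t < a) :
    ∃ r ∈ ims t, r ≤ a ∧ ∀ y, t < y → y ≤ a → r ≤ y := by
  have hne : {o : Ordinal | ∃ y, t < y ∧ y ≤ a ∧ htx y = o}.Nonempty := ⟨_, a, h, le_rfl, rfl⟩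
  obtain ⟨r, htr, hra, hr⟩ := csInf_mem hne
  have hmin : ∀ y, t < y → y ≤ a → r ≤ y := by
    intro y hty hya
    rcases htree.le_total_of_le hra hya with h1 | h1
    · exact h1
    rcases h1.eq_or_lt with rfl | h1
    · exact le_rfl
    have h2 : htx r ≤ htx y := hr ▸ csInf_le' ⟨y, hty, hya, rfl⟩
    exact absurd (htree.htx_lt h1) h2.not_gt
  refine ⟨r, ⟨htr, le_antisymm (le_of_not_gt fun hlt => ?_) ?_⟩, hra, hmin⟩
  · obtain ⟨y, hyr, hy⟩ := htree.exists_htx_eq hlt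
    have hty : t < y := by
      rcases htree.le_total_of_le hyr.le htr.le with h1 | h1
      · rcases h1.eq_or_lt with rfl | h1
        · simp at hy
        · have := htree.htx_lt h1
          rw [hy] at this
          exact absurd this (not_lt.2 le_self_add)
      · rcases h1.eq_or_lt with rfl | h1
        · simp at hy
        · exact h1
    exact hyr.not_ge (hmin y hty (hyr.le.trans hra))
  · rw [← Order.succ_eq_add_one]
    exact Order.succ_le_of_lt (htree.htx_lt htr)

lemma succLevel_of_mem_ims {t r : T} (h : r ∈ ims t) : SuccLevel r := ⟨_, h.2⟩

lemma exists_isGreatest_inter (htree : IsTreeOrder T) (hcc : ChainComplete T) (s t : T) :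
    ∃ m, IsGreatest {r : T | r ≤ s ∧ r ≤ t} m := by
  obtain ⟨m, hm⟩ := hcc {r : T | r ≤ s ∧ r ≤ t}
    fun x hx y hy _ => htree.le_total_of_le hx.1 hy.1
  exact ⟨m, ⟨hm.2 fun x hx => hx.1, hm.2 fun x hx => hx.2⟩, hm.1⟩

lemma wedge_eq_of_isGreatest {s t m : T} (h : IsGreatest {r : T | r ≤ s ∧ r ≤ t} m) :
    wedge s t = m := by
  have hex : ∃ m, IsGreatest {r : T | r ≤ s ∧ r ≤ t} m := ⟨m, h⟩
  rw [wedge, dif_pos hex]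
  exact hex.choose_spec.unique h

lemma isGreatest_wedge (htree : IsTreeOrder T) (hcc : ChainComplete T) (s t : T) :
    IsGreatest {r : T | r ≤ s ∧ r ≤ t} (wedge s t) := by
  obtain ⟨m, hm⟩ := exists_isGreatest_inter htree hcc s t
  rwa [wedge_eq_of_isGreatest hm]

lemma SuccLevel.cfx_eq_one {x : T} (h : SuccLevel x) : cfx x = 1 := by
  obtain ⟨β, hβ⟩ := h
  rw [cfx, hβ, Ordinal.cof_add_one]

lemma not_succLevel_of_cfx_eq_aleph0 {x : T} (h : cfx x = ℵ₀) : ¬ SuccLevel x := fun hs =>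
  Cardinal.one_lt_aleph0.ne (hs.cfx_eq_one.symm.trans h)

lemma isOpen_Vset [τ : TopologicalSpace T] (hτ : τ = coarseWedge T) {s : T} (hs : SuccLevel s) :
    IsOpen (Vset s) := by
  subst hτ
  exact TopologicalSpace.isOpen_generateFrom_of_mem ⟨s, Or.inr hs, Or.inl rfl⟩

lemma isOpen_compl_Vset [τ : TopologicalSpace T] (hτ : τ = coarseWedge T) {s : T}
    (hs : SuccLevel s) : IsOpen (Vset s)ᶜ := by
  subst hτ
  exact TopologicalSpace.isOpen_generateFrom_of_mem ⟨s, Or.inr hs, Or.inr rfl⟩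

lemma cfx_cases (htree : IsTreeOrder T) {s m : T} (hs : SuccLevel s) (hsm : s ≤ m) :
    SuccLevel m ∨ cfx m = ℵ₀ ∨ aleph 1 ≤ cfx m := by
  rcases hsm.eq_or_lt with rfl | hsm
  · exact Or.inl hs
  rcases lt_trichotomy (cfx m) ℵ₀ with h | h | h
  · left
    have h0 : htx m ≠ 0 := (bot_le.trans_lt (htree.htx_lt hsm)).ne'
    rcases Ordinal.zero_or_succ_or_isSuccLimit (htx m) with h1 | ⟨b, h1⟩ | h1
    · exact absurd h1 h0
    · exact ⟨b, by simpa using h1.symm⟩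
    · exact absurd (Ordinal.aleph0_le_cof_iff.2 (Ordinal.one_lt_cof_iff.2 h1)) h.not_ge
  · exact Or.inr (Or.inl h)
  · right; right
    rw [← Cardinal.succ_aleph0]
    exact Order.succ_le_of_lt h

/-- A point of `closure A \ A` of countable cofinality is approached by points of `A` outside its
wedge. -/
lemma exists_mem_not_le_of_mem_closure [τ : TopologicalSpace T] (hτ : τ = coarseWedge T)
    (htree : IsTreeOrder T) (hcc : ChainComplete T) {A : Set T}
    (hA : ∀ s ∈ A, ∀ t ∈ A, wedge s t ∈ A) {t : T} (htcl : t ∈ closure A) (htA : t ∉ A)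
    {s : T} (hs : SuccLevel s) (hst : s ≤ t) : ∃ a ∈ A, s ≤ a ∧ ¬ t ≤ a := by
  by_cases h : ∃ a ∈ A, t ≤ a
  · obtain ⟨a, haA, hta⟩ := h
    have hta' : t < a := hta.lt_of_ne fun h => htA (h ▸ haA)
    obtain ⟨r, hr, -, hmin⟩ := htree.exists_mem_ims_le hta'
    have hrs := succLevel_of_mem_ims hr
    obtain ⟨b, ⟨hsb, hrb⟩, hbA⟩ := mem_closure_iff.1 htcl _
      ((isOpen_Vset hτ hs).inter (isOpen_compl_Vset hτ hrs)) ⟨hst, hr.1.not_ge⟩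
    refine ⟨b, hbA, hsb, fun htb => hrb ?_⟩
    have hw := isGreatest_wedge htree hcc a b
    have htw : t < wedge a b := (hw.2 ⟨hta, htb⟩).lt_of_ne fun h =>
      htA (h ▸ hA a haA b hbA)
    exact (hmin _ htw hw.1.1).trans hw.1.2
  · obtain ⟨b, hsb, hbA⟩ := mem_closure_iff.1 htcl _ (isOpen_Vset hτ hs) hst
    exact ⟨b, hbA, hsb, fun htb => h ⟨b, hbA, htb⟩⟩

/-- The meet of `t` with a point of `A` outside its wedge belongs to `A`. -/
lemma wedge_mem_of_mem_closure [τ : TopologicalSpace T] (hτ : τ = coarseWedge T)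
    (htree : IsTreeOrder T) (hcc : ChainComplete T) {A : Set T}
    (hA : ∀ s ∈ A, ∀ t ∈ A, wedge s t ∈ A) {t : T} (htcl : t ∈ closure A)
    {a : T} (haA : a ∈ A) (hta : ¬ t ≤ a) : wedge a t ∈ A := by
  have hm := isGreatest_wedge htree hcc a t
  have hmt : wedge a t < t := hm.1.2.lt_of_ne fun h => hta (h ▸ hm.1.1)
  obtain ⟨p, hp, hpt, -⟩ := htree.exists_mem_ims_le hmt
  have hps := succLevel_of_mem_ims hp
  obtain ⟨b, hpb, hbA⟩ := mem_closure_iff.1 htcl _ (isOpen_Vset hτ hps) hpt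
  have hab : wedge a b = wedge a t := by
    refine wedge_eq_of_isGreatest ⟨⟨hm.1.1, hp.1.le.trans hpb⟩, fun x hx => ?_⟩
    rcases htree.le_total_of_le hx.2 hpb with h | h
    · exact hm.2 ⟨hx.1, h.trans hpt⟩
    · exact absurd (hm.2 ⟨h.trans hx.1, hpt⟩) hp.1.not_ge
  exact hab ▸ hA a haA b hbA

lemma exists_succLevel_between [τ : TopologicalSpace T] (hτ : τ = coarseWedge T)
    (htree : IsTreeOrder T) (hcc : ChainComplete T) {root : T} {φ : T → ℕ → T}
    (hφ : PhiSpec root φ) {A : Set T} (hA : Admissible root φ A) {t : T}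
    (htcl : t ∈ closure A) (htA : t ∉ A) (hcf : cfx t = ℵ₀)
    {s : T} (hs : SuccLevel s) (hst : s ≤ t) : ∃ a ∈ A, SuccLevel a ∧ s ≤ a ∧ a < t := by
  obtain ⟨a, haA, hsa, hta⟩ :=
    exists_mem_not_le_of_mem_closure hτ htree hcc hA.wedge_mem htcl htA hs hst
  have hmA := wedge_mem_of_mem_closure hτ htree hcc hA.wedge_mem htcl haA hta
  have hm := isGreatest_wedge htree hcc a t
  have hmt : wedge a t < t := hm.1.2.lt_of_ne fun h => hta (h ▸ hm.1.1)
  have hsm : s ≤ wedge a t := hm.2 ⟨hsa, hst⟩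
  rcases cfx_cases htree hs hsm with h | h | h
  · exact ⟨_, hmA, h, hsm, hmt⟩
  · obtain ⟨h1, h2⟩ := (hφ _).2 h
    obtain ⟨n, hn⟩ := (h2.eventually ((isOpen_Vset hτ hs).mem_nhds hsm)).exists
    exact ⟨_, hA.phi_mem _ hmA n, (h1 n).2, hn, (h1 n).1.trans hmt⟩
  · obtain ⟨p, hp, hpt, -⟩ := htree.exists_mem_ims_le hmt
    have hps := succLevel_of_mem_ims hp
    refine ⟨p, hA.psi_mem _ hmA ?_, hps, hsm.trans hp.1.le, hpt.lt_of_ne ?_⟩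
    · rwa [psiSet, if_pos h]
    · rintro rfl
      exact not_succLevel_of_cfx_eq_aleph0 hcf hps

lemma tendsto_of_le_of_lt [τ : TopologicalSpace T] (hτ : τ = coarseWedge T) {t : T}
    {u v : ℕ → T} (hu : Tendsto u atTop (𝓝 t)) (huv : ∀ n, u n ≤ v n) (hv : ∀ n, v n ≤ t) :
    Tendsto v atTop (𝓝 t) := by
  subst hτ
  rw [coarseWedge, TopologicalSpace.tendsto_nhds_generateFrom_iff] at hu ⊢
  rintro U ⟨r, hr, rfl | rfl⟩ htU
  · filter_upwards [hu _ ⟨r, hr, Or.inl rfl⟩ htU] with n hn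
    exact le_trans hn (huv n)
  · exact Eventually.of_forall fun n hn => htU (le_trans hn (hv n))

end TreeLemmas

theorem stmt4 {T : Type u} [PartialOrder T] [τ : TopologicalSpace T]
    (hτ : τ = coarseWedge T) (htree : IsTreeOrder T) (hcc : ChainComplete T)
    (root : T) (hroot : ∀ x : T, root ≤ x)
    (hstar : StarCond T) (φ : T → ℕ → T) (hφ : PhiSpec root φ)
    (A : Set T) (hA : Admissible root φ A)
    (t : T) (htcl : t ∈ closure A) (hcf : cfx t = Cardinal.aleph0) :
    ∃ u : ℕ → T, (∀ n, u n ∈ A) ∧ (∀ n, u n < t) ∧ (∀ n, SuccLevel (u n)) ∧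
      Tendsto u atTop (nhds t) := by
  obtain ⟨h1, h2⟩ := (hφ t).2 hcf
  by_cases htA : t ∈ A
  · exact ⟨φ t, hA.phi_mem t htA, fun n => (h1 n).1, fun n => (h1 n).2, h2⟩
  choose u huA hus hle hlt using fun n =>
    exists_succLevel_between hτ htree hcc hφ hA htcl htA hcf (h1 n).2 (h1 n).1.le
  exact ⟨u, huA, hlt, hus, tendsto_of_le_of_lt hτ h2 hle fun n => (hlt n).le⟩
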